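/- Let p > 2 be a prime and let K ≥ 8 be a real number. For every n ≥ 1 and every nonempty finite subset A of (ZMod p)^n, if |A + A| ≤ K·|A|, then the affine span of A satisfies |⟨A⟩| ≤ (p^(2K−2)/(2K−1))·|A|. -/

import Mathlib

open Pointwise

/-- The affine span of `A`: the smallest coset of a subgroup containing `A`,
realized as the intersection of all such cosets. -/
def affSpan {G : Type*} [AddCommGroup G] (A : Set G) : Set G :=
  ⋂₀ {C : Set G | A ⊆ C ∧ ∃ (H : AddSubgroup G) (g : G), C = g +ᵥ (H : Set G)}

namespace FR

/-- The extremal function. -/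
noncomputable def F (p : ℝ) (t : ℝ) : ℝ := p ^ t / (1 + t)

lemma rpow_eq {p : ℝ} (hp : 0 < p) (t : ℝ) : p ^ t = Real.exp (Real.log p * t) :=
  Real.rpow_def_of_pos hp t

lemma log_three_ge : (1 : ℝ) ≤ Real.log 3 := by
  rw [Real.le_log_iff_exp_le (by norm_num)]
  have := Real.exp_one_lt_d9
  linarith

lemma log_three_le : Real.log 3 ≤ 5 / 4 := by
  rw [Real.log_le_iff_le_exp (by norm_num)]
  have h1 : (5 / 4 : ℝ) ≤ Real.exp (1 / 4) := by
    have := Real.add_one_le_exp (1 / 4 : ℝ)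
    linarith
  have h2 : Real.exp (5 / 4) = Real.exp (1 / 4) ^ 5 := by
    rw [← Real.exp_nat_mul]; norm_num
  rw [h2]
  calc (3 : ℝ) ≤ (5 / 4) ^ 5 := by norm_num
    _ ≤ _ := by gcongr

lemma log_five_ge {p : ℝ} (hp : 5 ≤ p) : (3 / 2 : ℝ) ≤ Real.log p := by
  have h5 : (3 / 2 : ℝ) ≤ Real.log 5 := by
    have h : Real.log 25 = 2 * Real.log 5 := by
      rw [show (25 : ℝ) = 5 ^ 2 by norm_num, Real.log_pow]; norm_num
    have h3 : (3 : ℝ) ≤ Real.log 25 := by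
      rw [Real.le_log_iff_exp_le (by norm_num)]
      have h2 : Real.exp 3 = Real.exp 1 ^ 3 := by
        rw [← Real.exp_nat_mul]; norm_num
      rw [h2]
      calc Real.exp 1 ^ 3 ≤ (2.7182818286 : ℝ) ^ 3 := by
            gcongr
            exact Real.exp_one_lt_d9.le
        _ ≤ 25 := by norm_num
    linarith
  exact h5.trans (Real.log_le_log (by norm_num) hp)

lemma log_ge_one {p : ℝ} (hp : 3 ≤ p) : (1 : ℝ) ≤ Real.log p :=
  log_three_ge.trans (Real.log_le_log (by norm_num) hp)

lemma F_mono {p : ℝ} (hp : 3 ≤ p) {s t : ℝ} (hs : 0 ≤ s) (hst : s ≤ t) : F p s ≤ F p t := by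
  have hp0 : 0 < p := by linarith
  have hL := log_ge_one hp
  unfold F
  rw [div_le_div_iff₀ (by linarith) (by linarith)]
  have h1 : p ^ t = p ^ s * p ^ (t - s) := by
    rw [← Real.rpow_add hp0]; congr 1; ring
  rw [h1]
  have h2 : 1 + (t - s) ≤ p ^ (t - s) := by
    rw [rpow_eq hp0]
    have := Real.add_one_le_exp (Real.log p * (t - s))
    nlinarith
  have h3 : 0 < p ^ s := Real.rpow_pos_of_pos hp0 s
  have h4 : 1 + t ≤ p ^ (t - s) * (1 + s) := by nlinarith
  calc p ^ s * (1 + t) ≤ p ^ s * (p ^ (t - s) * (1 + s)) := by gcongr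
    _ = _ := by ring

lemma F_zero (p : ℝ) : F p 0 = 1 := by simp [F]

lemma F_one (p : ℝ) : F p 1 = p / 2 := by simp [F]; norm_num

lemma F3_two : F 3 2 = 3 := by
  unfold F
  rw [show (2 : ℝ) = ((2 : ℕ) : ℝ) by norm_num, Real.rpow_natCast]; norm_num

/-- general tool: product of two linear factors below an exponential -/
lemma two_factor {x y : ℝ} (hx : 0 ≤ 1 + x) : (1 + x) * (1 + y) ≤ Real.exp (x + y) := by
  rw [Real.exp_add]
  have h1 := Real.add_one_le_exp x
  have h2 := Real.add_one_le_exp y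
  have h3 := Real.exp_pos y
  calc (1 + x) * (1 + y) ≤ (1 + x) * Real.exp y := by
        apply mul_le_mul_of_nonneg_left _ hx; linarith
    _ ≤ _ := by
        apply mul_le_mul_of_nonneg_right _ h3.le; linarith

lemma core {p b w : ℝ} (hp : 3 ≤ p) (hb : 0 ≤ b) (hw : (b + 1) / (b + 2) ≤ w)
    (hL : (b + 2) + (b + 1) ≤ Real.log p * (b + 2) * (b + 1)) :
    p * F p b * w ≤ F p ((b + 2) * w) := by
  have hp0 : 0 < p := by linarith
  obtain ⟨d, hd⟩ : ∃ d, d = w - (b + 1) / (b + 2) := ⟨_, rfl⟩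
  have hd0 : 0 ≤ d := by linarith
  have hwd : w = (b + 1) / (b + 2) + d := by linarith
  have hw0 : 0 < w := lt_of_lt_of_le (by positivity) hw
  have ht : (b + 2) * w = (b + 1) + (b + 2) * d := by
    rw [hwd]; field_simp
  unfold F
  rw [ht]
  have h1 : p ^ (b + 1 + (b + 2) * d) = p * p ^ b * p ^ ((b + 2) * d) := by
    rw [Real.rpow_add hp0, Real.rpow_add hp0, Real.rpow_one]; ring
  have h2 : (1 + d * (b + 2) / (b + 1)) * (1 + d) ≤ p ^ ((b + 2) * d) := by
    rw [rpow_eq hp0]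
    refine (two_factor (by positivity)).trans ?_
    apply Real.exp_le_exp.mpr
    have : d * (b + 2) / (b + 1) + d = d * (((b + 2) + (b + 1)) / (b + 1)) := by field_simp
    rw [this]
    have h : ((b + 2) + (b + 1)) / (b + 1) ≤ Real.log p * (b + 2) := by
      rw [div_le_iff₀ (by linarith)]; exact hL
    nlinarith
  rw [le_div_iff₀ (by positivity), h1]
  have h3 : 0 < p ^ b := Real.rpow_pos_of_pos hp0 b
  have h4 : p * (p ^ b / (1 + b)) * w * (1 + (b + 1 + (b + 2) * d))
      = p * p ^ b * ((1 + d * (b + 2) / (b + 1)) * (1 + d)) := by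
    rw [hwd]; field_simp; ring
  rw [h4]
  gcongr

/-- for p ≥ 5, K ≤ F (2K-2) -/
lemma F_full {p K : ℝ} (hp : 5 ≤ p) (hK : 1 ≤ K) : K ≤ F p (2 * K - 2) := by
  have hp0 : 0 < p := by linarith
  have hL := log_five_ge hp
  unfold F
  rw [le_div_iff₀ (by linarith), rpow_eq hp0]
  have := two_factor (x := K - 1) (y := 2 * (K - 1)) (by linarith)
  calc K * (1 + (2 * K - 2)) = (1 + (K - 1)) * (1 + 2 * (K - 1)) := by ring
    _ ≤ _ := this
    _ ≤ _ := by
      apply Real.exp_le_exp.mpr; nlinarith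

/-- for p ≥ 5, p t / 2 ≤ F t for t ≥ 1 -/
lemma F_lin5 {p t : ℝ} (hp : 5 ≤ p) (ht : 1 ≤ t) : p * t / 2 ≤ F p t := by
  have hp0 : 0 < p := by linarith
  have hL := log_five_ge hp
  unfold F
  rw [le_div_iff₀ (by linarith)]
  have h1 : p ^ t = p * p ^ (t - 1) := by
    nth_rewrite 2 [← Real.rpow_one p]
    rw [← Real.rpow_add hp0]; congr 1; ring
  rw [h1, rpow_eq hp0]
  have := two_factor (x := t - 1) (y := (t - 1) / 2) (by linarith)
  have h2 : Real.exp (t - 1 + (t - 1) / 2) ≤ Real.exp (Real.log p * (t - 1)) := by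
    apply Real.exp_le_exp.mpr; nlinarith
  calc p * t / 2 * (1 + t) = p * ((1 + (t - 1)) * (1 + (t - 1) / 2)) := by ring
    _ ≤ _ := by gcongr; exact this.trans h2

lemma F3_lin {t : ℝ} (ht : 2 ≤ t) : 3 * t / 2 ≤ F 3 t := by
  have hL := log_three_ge
  unfold F
  rw [le_div_iff₀ (by linarith)]
  have h1 : (3 : ℝ) ^ t = 9 * (3 : ℝ) ^ (t - 2) := by
    rw [show (9 : ℝ) = 3 ^ (2 : ℝ) by norm_num, ← Real.rpow_add (by norm_num)]; congr 1; ring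
  rw [h1, rpow_eq (by norm_num)]
  have := two_factor (x := (t - 2) / 2) (y := (t - 2) / 3) (by linarith)
  have h2 : Real.exp ((t - 2) / 2 + (t - 2) / 3) ≤ Real.exp (Real.log 3 * (t - 2)) := by
    apply Real.exp_le_exp.mpr; nlinarith
  calc 3 * t / 2 * (1 + t) = 9 * ((1 + (t - 2) / 2) * (1 + (t - 2) / 3)) := by ring
    _ ≤ _ := by gcongr; exact this.trans h2

lemma F3_tangent {t : ℝ} (ht : -1 < t) :
    27 / 4 + 27 / 4 * (Real.log 3 - 1 / 4) * (t - 3) ≤ F 3 t := by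
  unfold F
  rw [le_div_iff₀ (by linarith)]
  have h1 : (3 : ℝ) ^ t = 27 * (3 : ℝ) ^ (t - 3) := by
    rw [show (27 : ℝ) = 3 ^ (3 : ℝ) by norm_num, ← Real.rpow_add (by norm_num)]; congr 1; ring
  rw [h1, rpow_eq (by norm_num)]
  have := two_factor (x := (t - 3) / 4) (y := (Real.log 3 - 1 / 4) * (t - 3)) (by linarith)
  calc _ = 27 * ((1 + (t - 3) / 4) * (1 + (Real.log 3 - 1 / 4) * (t - 3))) := by ring
    _ ≤ _ := by
      gcongr
      refine this.trans (le_of_eq ?_)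
      congr 1; ring

/-- The inductive inequality. -/
def Good (p N a M : ℝ) : Prop :=
  (5 ≤ p ∧ N ≤ a * F p (2 * (M / a) - 2)) ∨
  (p = 3 ∧ (N ≤ M ∨ (M ≤ 2 * a ∧ N ≤ 3 * (M - a)) ∨
    (2 * a ≤ M ∧ N ≤ a * F 3 (2 * (M / a) - 2))))

lemma Good.mono {p N a M a' M' : ℝ} (h : Good p N a M) (ha : 0 < a) (haM : a ≤ M)
    (haa : a ≤ a') (hK : M / a ≤ M' / a') : Good p N a' M' := by
  have ha' : 0 < a' := by linarith
  have h1 : 1 ≤ M / a := by rwa [le_div_iff₀ ha, one_mul]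
  have hM : M = M / a * a := by field_simp
  have hM' : M' = M' / a' * a' := by field_simp
  set k := M / a with hk
  set k' := M' / a' with hk'
  rcases h with ⟨hp, h⟩ | ⟨hp, h | ⟨h2, h⟩ | ⟨h2, h⟩⟩
  · left
    refine ⟨hp, h.trans ?_⟩
    have := F_mono (p := p) (by linarith) (s := 2 * k - 2) (t := 2 * k' - 2) (by linarith) (by linarith)
    have h0 : F p 0 ≤ F p (2 * k - 2) := F_mono (by linarith) le_rfl (by linarith)
    rw [F_zero] at h0
    nlinarith
  · right
    refine ⟨hp, Or.inl ?_⟩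
    nlinarith
  · right
    refine ⟨hp, Or.inr ?_⟩
    rcases le_total M' (2 * a') with h3 | h3
    · left
      refine ⟨h3, ?_⟩
      nlinarith
    · right
      refine ⟨h3, ?_⟩
      have hk2 : 2 ≤ k' := by
        rw [hk', le_div_iff₀ ha']; exact h3
      have := F_mono (p := 3) le_rfl (s := 2) (t := 2 * k' - 2) (by norm_num) (by linarith)
      rw [F3_two] at this
      nlinarith
  · right
    refine ⟨hp, Or.inr (Or.inr ?_)⟩
    have hk2 : 2 ≤ k := by
      rw [hk, le_div_iff₀ ha]; exact h2
    refine ⟨by nlinarith, h.trans ?_⟩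
    have := F_mono (p := 3) le_rfl (s := 2 * k - 2) (t := 2 * k' - 2) (by linarith) (by linarith)
    have h0 : F 3 0 ≤ F 3 (2 * k - 2) := F_mono (by linarith) le_rfl (by linarith)
    rw [F_zero] at h0
    nlinarith

lemma Good.scale {p N a M h : ℝ} (hg : Good p N a M) (hh : 0 < h) :
    Good p (h * N) (h * a) (h * M) := by
  unfold Good at *
  have : h * M / (h * a) = M / a := by field_simp
  rw [this]
  rcases hg with ⟨hp, g⟩ | ⟨hp, g | ⟨h2, g⟩ | ⟨h2, g⟩⟩
  · left; exact ⟨hp, by nlinarith⟩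
  · right; exact ⟨hp, Or.inl (by nlinarith)⟩
  · right; exact ⟨hp, Or.inr (Or.inl ⟨by nlinarith, by nlinarith⟩)⟩
  · right; exact ⟨hp, Or.inr (Or.inr ⟨by nlinarith, by nlinarith⟩)⟩

lemma Good.full {p N a M : ℝ} (hp : 5 ≤ p ∨ p = 3) (ha : 0 < a) (haM : a ≤ M) (h : N ≤ M) :
    Good p N a M := by
  rcases hp with hp | hp
  · left
    refine ⟨hp, h.trans ?_⟩
    have h1 : 1 ≤ M / a := by rwa [le_div_iff₀ ha, one_mul]
    have := F_full hp h1
    rwa [div_le_iff₀ ha, mul_comm] at this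
  · right; exact ⟨hp, Or.inl h⟩

lemma Good.beta {p N' a M : ℝ} (hp : 5 ≤ p ∨ p = 3) (hN : 0 < N') (ha : N' ≤ a)
    (h1 : a + N' ≤ M) (h2 : 2 * a - N' ≤ M) : Good p (p * N') a M := by
  have ha0 : 0 < a := by linarith
  have hMa : M / a * a = M := by field_simp
  set k := M / a with hk
  have hNa : 0 < N' / a := by positivity
  rcases hp with hp | hp
  · left
    refine ⟨hp, ?_⟩
    rcases le_total (2 * N') a with h3 | h3
    · have hk : 3 / 2 ≤ k := by
        rw [hk, le_div_iff₀ ha0]; linarith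
      have := F_mono (p := p) (by linarith) (s := 1) (t := 2 * k - 2) (by norm_num) (by linarith)
      rw [F_one] at this
      nlinarith
    · have hk : 1 + N' / a ≤ k := by
        rw [hk, le_div_iff₀ ha0, add_mul, div_mul_cancel₀ _ ha0.ne']; linarith
      have h4 : 1 ≤ 2 * (N' / a) := by
        rw [← mul_div_assoc, le_div_iff₀ ha0]; linarith
      have h5 := F_lin5 hp h4
      have := F_mono (p := p) (by linarith) (s := 2 * (N' / a)) (t := 2 * k - 2) (by linarith) (by linarith)
      have h6 : p * (2 * (N' / a)) / 2 ≤ F p (2 * k - 2) := h5.trans this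
      calc p * N' = a * (p * (2 * (N' / a)) / 2) := by field_simp
        _ ≤ _ := by gcongr
  · right
    refine ⟨hp, Or.inr ?_⟩
    subst hp
    rcases le_total M (2 * a) with h3 | h3
    · left; exact ⟨h3, by linarith⟩
    · right
      refine ⟨h3, ?_⟩
      have hk2 : 2 ≤ k := by
        rw [hk, le_div_iff₀ ha0]; exact h3
      have := F_mono (p := 3) le_rfl (s := 2) (t := 2 * k - 2) (by norm_num) (by linarith)
      rw [F3_two] at this
      nlinarith

lemma gamma_third {p N0 r m g : ℝ} (hp : 3 ≤ p) (hr : 0 < r) (hg0 : 0 < g) (hg1 : g ≤ 1)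
    (hm1 : r ≤ m) (hm2 : m ≤ r * (r + 1) / 2)
    (hL : ∀ b, b = 2 * (m / r) - 2 → (b + 2) + (b + 1) ≤ Real.log p * (b + 2) * (b + 1))
    (h : N0 ≤ r * F p (2 * (m / r) - 2)) :
    p * N0 ≤ (r + g) * F p (2 * ((m + r + g) / (r + g)) - 2) := by
  have hmr : 1 ≤ m / r := by rwa [le_div_iff₀ hr, one_mul]
  have hmr2 : m / r ≤ (r + 1) / 2 := by rw [div_le_iff₀ hr]; linarith
  obtain ⟨b, hb⟩ : ∃ b, b = 2 * (m / r) - 2 := ⟨_, rfl⟩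
  rw [← hb] at h
  have hb0 : 0 ≤ b := by linarith
  have hbr : b + 2 ≤ r + 1 := by linarith
  have hrg : 0 < r + g := by linarith
  have hw : (b + 1) / (b + 2) ≤ r / (r + g) := by
    rw [div_le_div_iff₀ (by linarith) hrg]; nlinarith
  have := core hp hb0 hw (hL b hb)
  have e : (b + 2) * (r / (r + g)) = 2 * ((m + r + g) / (r + g)) - 2 := by
    rw [hb]; field_simp; ring
  rw [e] at this
  calc p * N0 ≤ p * (r * F p b) := by gcongr
    _ = (r + g) * (p * F p b * (r / (r + g))) := by field_simp
    _ ≤ _ := by gcongr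

lemma Good.gamma {p N0 r m g : ℝ} (hp : 5 ≤ p ∨ p = 3) (hN : p = 3 → N0 = 3 ∨ 9 ≤ N0)
    (hr : 2 ≤ r) (hg0 : 0 < g) (hg1 : g ≤ 1)
    (hm1 : r ≤ m) (hm2 : m ≤ r * (r + 1) / 2) (h : Good p N0 r m) :
    Good p (p * N0) (r + g) (m + r + g) := by
  have hrg : 0 < r + g := by linarith
  have hr0 : 0 < r := by linarith
  have hmr : 1 ≤ m / r := by rwa [le_div_iff₀ hr0, one_mul]
  rcases h with ⟨hp5, h⟩ | ⟨hp3, h⟩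
  · left
    refine ⟨hp5, gamma_third (by linarith) hr0 hg0 hg1 hm1 hm2 ?_ h⟩
    intro b hb
    have hb0 : 0 ≤ b := by linarith
    have := log_five_ge hp5
    have h1 : 0 ≤ (b + 2) * (b + 1) := by positivity
    nlinarith
  · right
    refine ⟨hp3, ?_⟩
    have hN2 := hN hp3
    have hm0 : 0 < m := by linarith
    subst hp3
    by_cases hi : N0 ≤ m
    · right
      rcases le_total (m + r + g) (2 * (r + g)) with h3 | h3
      · left; exact ⟨h3, by linarith⟩
      · right
        refine ⟨h3, ?_⟩
        have e : 2 * ((m + r + g) / (r + g)) - 2 = 2 * m / (r + g) := by field_simp; ring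
        have h4 : 2 ≤ 2 * m / (r + g) := by rw [le_div_iff₀ hrg]; linarith
        have h5 := F3_lin h4
        rw [e]
        calc 3 * N0 ≤ 3 * m := by linarith
          _ = (r + g) * (3 * (2 * m / (r + g)) / 2) := by field_simp
          _ ≤ _ := by gcongr
    · rcases h with h | ⟨h2, h⟩ | ⟨h2, h⟩
      · exact absurd h hi
      · right; right
        have h9 : 9 ≤ N0 := by
          rcases hN2 with hN | hN
          · push Not at hi; linarith
          · exact hN
        have h3 : r + 3 ≤ m := by linarith
        refine ⟨by linarith, ?_⟩
        have e : 2 * ((m + r + g) / (r + g)) - 2 = 2 * m / (r + g) := by field_simp; ring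
        rw [e]
        have ht : -1 < 2 * m / (r + g) := lt_of_lt_of_le (by norm_num : (-1 : ℝ) < 0) (by positivity)
        have h5 := F3_tangent ht
        have hl1 := log_three_ge
        have hl2 := log_three_le
        set q := 27 / 4 * (Real.log 3 - 1 / 4) with hq
        have hq1 : 9 / 2 ≤ q := by linarith
        have hq2 : q ≤ 27 / 4 := by linarith
        have h6 : (r + g) * (27 / 4 + q * (2 * m / (r + g) - 3)) ≤ (r + g) * F 3 (2 * m / (r + g)) := by
          gcongr
        have h7 : (r + g) * (27 / 4 + q * (2 * m / (r + g) - 3))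
            = 27 / 4 * (r + g) + q * (2 * m - 3 * (r + g)) := by field_simp
        rw [h7] at h6
        refine le_trans ?_ h6
        have h8 : (0 : ℝ) ≤ (q - 9 / 2) * (m - r - 3) := mul_nonneg (by linarith) (by linarith)
        have h10 : (0 : ℝ) ≤ (27 / 4 - q) * (r - 3) := mul_nonneg (by linarith) (by linarith)
        have h11 : (0 : ℝ) ≤ (3 * q - 27 / 4) * (1 - g) := mul_nonneg (by linarith) (by linarith)
        nlinarith
      · right; right
        refine ⟨by linarith, gamma_third le_rfl hr0 hg0 hg1 hm1 hm2 ?_ h⟩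
        intro b hb
        have hb0 : 2 ≤ m / r := by rw [le_div_iff₀ hr0]; linarith
        have hb1 : 2 ≤ b := by linarith
        have := log_three_ge
        have h1 : 0 ≤ (b + 2) * (b + 1) := by positivity
        nlinarith

lemma Good.delta {p N r m g l : ℝ} (hr : 4 ≤ r) (hg1 : 1 ≤ g) (hgl : g ≤ l) (hl : 2 ≤ l)
    (hm1 : r ≤ m) (hm2 : m ≤ r * (r + 1) / 2) (h : Good p N (r + 1) (m + r + 1)) :
    Good p N (r + g) (m + l * r) := by
  refine h.mono (by linarith) (by linarith) (by linarith) ?_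
  rw [div_le_div_iff₀ (by linarith) (by linarith)]
  have key : (g - 1) * r / 2 ≤ (l - 1) * r - g := by
    rcases le_total g 2 with h2 | h2
    · nlinarith
    · nlinarith
  nlinarith

lemma Good.final {p N a M K : ℝ} (h : Good p N a M) (ha : 0 < a) (haM : a ≤ M) (hK : 8 ≤ K)
    (hM : M ≤ K * a) : N ≤ p ^ (2 * K - 2) / (2 * K - 1) * a := by
  have h' : Good p N a (K * a) := h.mono ha haM le_rfl (by gcongr)
  have e : K * a / a = K := by field_simp
  have eF : ∀ p, p ^ (2 * K - 2) / (2 * K - 1) = F p (2 * K - 2) := by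
    intro p; unfold F; congr 1; ring
  rw [eF]
  unfold Good at h'
  rw [e] at h'
  rcases h' with ⟨hp, g⟩ | ⟨hp, g | ⟨h2, g⟩ | ⟨h2, g⟩⟩
  · linarith
  · have := F3_lin (t := 2 * K - 2) (by linarith)
    rw [hp]
    nlinarith
  · nlinarith
  · rw [hp]; linarith

end FR

namespace FR
open Finset
set_option linter.unusedSectionVars false

section
variable {p : ℕ} [Fact p.Prime] {W : Type} [AddCommGroup W] [Module (ZMod p) W] [Fintype W]
  [DecidableEq W]

def sl (A : Finset (W × ZMod p)) (i : ZMod p) : Finset W := univ.filter (fun w => (w, i) ∈ A)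
def fib (A : Finset (W × ZMod p)) (w : W) : Finset (ZMod p) := univ.filter (fun i => (w, i) ∈ A)
def comp (A : Finset (W × ZMod p)) : Finset (W × ZMod p) :=
  univ.filter (fun x => x.2.val < #(fib A x.1))

@[simp] lemma mem_sl {A : Finset (W × ZMod p)} {i w} : w ∈ sl A i ↔ (w, i) ∈ A := by simp [sl]
@[simp] lemma mem_fib {A : Finset (W × ZMod p)} {i w} : i ∈ fib A w ↔ (w, i) ∈ A := by simp [fib]
lemma mem_comp {A : Finset (W × ZMod p)} {i w} : (w, i) ∈ comp A ↔ i.val < #(fib A w) := by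
  simp [comp]

lemma card_eq_fib (A : Finset (W × ZMod p)) : #A = ∑ w, #(fib A w) := by
  rw [Finset.card_eq_sum_card_fiberwise (f := Prod.fst) (t := univ) (fun _ _ => by simp)]
  refine Finset.sum_congr rfl fun w _ => ?_
  refine Finset.card_bij' (fun x _ => x.2) (fun i _ => (w, i)) ?_ ?_ ?_ ?_
  · rintro ⟨a, b⟩ h; simp at h; obtain ⟨h, rfl⟩ := h; simpa using h
  · intro i hi; simpa using hi
  · rintro ⟨a, b⟩ h; simp at h; simp [h.2]
  · intro i hi; rfl

lemma card_eq_sl (A : Finset (W × ZMod p)) : #A = ∑ i, #(sl A i) := by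
  rw [Finset.card_eq_sum_card_fiberwise (f := Prod.snd) (t := univ) (fun _ _ => by simp)]
  refine Finset.sum_congr rfl fun w _ => ?_
  refine Finset.card_bij' (fun x _ => x.1) (fun i _ => (i, w)) ?_ ?_ ?_ ?_
  · rintro ⟨a, b⟩ h; simp at h; obtain ⟨h, rfl⟩ := h; simpa using h
  · intro i hi; simpa using hi
  · rintro ⟨a, b⟩ h; simp at h; simp [h.2]
  · intro i hi; rfl

lemma card_val_lt {c : ℕ} (hc : c ≤ p) : #(univ.filter (fun i : ZMod p => i.val < c)) = c := by
  conv_rhs => rw [← Finset.card_range c]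
  refine Finset.card_bij' (fun x _ => x.val) (fun i _ => (i : ZMod p)) ?_ ?_ ?_ ?_
  · intro x h; simpa using h
  · intro i hi
    simp at hi
    simp [ZMod.val_natCast_of_lt (lt_of_lt_of_le hi hc), hi]
  · intro x h; simp
  · intro i hi
    simp at hi
    simp [ZMod.val_natCast_of_lt (lt_of_lt_of_le hi hc)]

lemma card_fib_le (A : Finset (W × ZMod p)) (w : W) : #(fib A w) ≤ p := by
  have := Finset.card_le_univ (fib A w)
  rwa [ZMod.card] at this

lemma card_comp (A : Finset (W × ZMod p)) : #(comp A) = #A := by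
  rw [card_eq_fib, card_eq_fib A]
  refine Finset.sum_congr rfl fun w _ => ?_
  have : fib (comp A) w = univ.filter (fun i : ZMod p => i.val < #(fib A w)) := by
    ext i; simp [mem_comp]
  rw [this, card_val_lt (card_fib_le A w)]

lemma comp_add_subset (A : Finset (W × ZMod p)) : comp A + comp A ⊆ comp (A + A) := by
  intro x hx
  obtain ⟨⟨w1, i1⟩, h1, ⟨w2, i2⟩, h2, rfl⟩ := Finset.mem_add.1 hx
  rw [mem_comp] at h1 h2
  rw [Prod.mk_add_mk, mem_comp]
  have hs : fib A w1 + fib A w2 ⊆ fib (A + A) (w1 + w2) := by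
    intro i hi
    obtain ⟨a, ha, b, hb, rfl⟩ := Finset.mem_add.1 hi
    rw [mem_fib] at *
    exact Finset.mem_add.2 ⟨_, ha, _, hb, rfl⟩
  have hcd := ZMod.cauchy_davenport (Fact.out : p.Prime) (s := fib A w1) (t := fib A w2)
    (Finset.card_pos.1 (by omega)) (Finset.card_pos.1 (by omega))
  have := Finset.card_le_card hs
  have hlt := ZMod.val_lt (i1 + i2)
  have hle := ZMod.val_add_le i1 i2
  rcases min_le_iff.1 hcd with h | h <;> omega

lemma card_comp_add (A : Finset (W × ZMod p)) : #(comp A + comp A) ≤ #(A + A) :=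
  (Finset.card_le_card (comp_add_subset A)).trans (card_comp _).le

lemma sl_subset_comp (A : Finset (W × ZMod p)) : sl A 0 ⊆ sl (comp A) 0 := by
  intro w hw
  rw [mem_sl] at *
  rw [mem_comp, ZMod.val_zero]
  exact Finset.card_pos.2 ⟨0, by simpa using hw⟩

def shear (y : W) : (W × ZMod p) →+ (W × ZMod p) where
  toFun x := (x.1 + x.2 • y, x.2)
  map_zero' := by simp
  map_add' a b := by
    ext
    · simp [add_smul]; abel
    · simp

lemma shear_apply (y : W) (x : W × ZMod p) : shear y x = (x.1 + x.2 • y, x.2) := rfl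
lemma shear_inj (y : W) : Function.Injective (shear (p := p) y) := by
  rintro ⟨a, b⟩ ⟨c, d⟩ h
  simp only [shear_apply, Prod.mk.injEq] at h
  obtain ⟨h, rfl⟩ := h
  simpa using h

structure Fam (a M : ℕ) (A : Finset (W × ZMod p)) : Prop where
  c1 : #A = a
  c2 : #(A + A) ≤ M
  z : (0, 0) ∈ A
  sp : Submodule.span (ZMod p) (sl A 0 : Set W) = ⊤
  ex : ∃ x ∈ A, x.2 ≠ 0

lemma mem_shear {A : Finset (W × ZMod p)} {y w : W} {i : ZMod p} :
    (w, i) ∈ A.image (shear y) ↔ (w - i • y, i) ∈ A := by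
  simp only [mem_image, shear_apply]
  constructor
  · rintro ⟨⟨a, b⟩, h, he⟩
    simp only [Prod.mk.injEq] at he
    obtain ⟨rfl, rfl⟩ := he
    simpa using h
  · intro h
    exact ⟨_, h, by simp⟩

lemma sl_shear (A : Finset (W × ZMod p)) (y : W) : sl (A.image (shear y)) 0 = sl A 0 := by
  ext w; rw [mem_sl, mem_shear]; simp

lemma Fam.shear {a M : ℕ} {A : Finset (W × ZMod p)} (h : Fam a M A) (y : W) :
    Fam a M (A.image (shear y)) where
  c1 := by rw [Finset.card_image_of_injective _ (shear_inj y), h.c1]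
  c2 := by
    rw [← Finset.image_add, Finset.card_image_of_injective _ (shear_inj y)]; exact h.c2
  z := by rw [mem_shear]; simpa using h.z
  sp := by rw [sl_shear]; exact h.sp
  ex := by
    obtain ⟨x, hx, hx2⟩ := h.ex
    exact ⟨_, Finset.mem_image_of_mem _ hx, hx2⟩

lemma Fam.comp {a M : ℕ} {A : Finset (W × ZMod p)} (h : Fam a M A)
    (hw : ∃ w, (w, (1 : ZMod p)) ∈ comp A) : Fam a M (comp A) where
  c1 := by rw [card_comp, h.c1]
  c2 := (card_comp_add A).trans h.c2
  z := by have := sl_subset_comp A (by simpa using h.z : (0 : W) ∈ sl A 0); simpa using this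
  sp := by
    rw [eq_top_iff, ← h.sp]
    exact Submodule.span_mono (by exact_mod_cast sl_subset_comp A)
  ex := by
    obtain ⟨w, hw⟩ := hw
    exact ⟨_, hw, one_ne_zero⟩

lemma one_mem_comp {A : Finset (W × ZMod p)} {w : W} {i : ZMod p} (hi : i ≠ 0) (h0 : (w, 0) ∈ A)
    (h1 : (w, i) ∈ A) : (w, 1) ∈ comp A := by
  have : Fact (1 < p) := ⟨(Fact.out : p.Prime).one_lt⟩
  rw [mem_comp, ZMod.val_one]
  exact Finset.one_lt_card.2 ⟨0, by simpa using h0, i, by simpa using h1, hi.symm⟩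

lemma exists_nested {a M : ℕ} {A₀ : Finset (W × ZMod p)} (h₀ : Fam a M A₀) :
    ∃ A : Finset (W × ZMod p), Fam a M A ∧ ((0 : W), (1 : ZMod p)) ∈ A ∧
      (∀ w i j, (w, i) ∈ A → j.val ≤ i.val → (w, j) ∈ A) ∧
      (∀ y ∈ sl A 0, ∀ j, ∀ x ∈ sl A j, x + j • y ∈ sl A 0) := by
  classical
  obtain ⟨A, hA, hmax⟩ := Finset.exists_max_image
    (univ.filter (fun A : Finset (W × ZMod p) => Fam a M A)) (fun A => #(sl A 0)) ⟨A₀, by simpa using h₀⟩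
  simp only [mem_filter, mem_univ, true_and] at hA hmax
  obtain ⟨⟨x, i⟩, hx, hi⟩ := hA.ex
  simp only at hi
  set A1 := A.image (shear (-(i⁻¹ • x))) with hA1
  have f1 : Fam a M A1 := hA.shear _
  have m1 : (0, i) ∈ A1 := by
    rw [hA1, mem_shear]
    simpa [smul_smul, hi] using hx
  have m2 : ((0 : W), (1 : ZMod p)) ∈ FR.comp A1 := one_mem_comp hi f1.z m1
  have f2 : Fam a M (FR.comp A1) := f1.comp ⟨_, m2⟩
  have hc : #(sl A 0) ≤ #(sl (FR.comp A1) 0) := by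
    rw [← sl_shear A (-(i⁻¹ • x))]
    exact Finset.card_le_card (sl_subset_comp _)
  refine ⟨FR.comp A1, f2, m2, ?_, ?_⟩
  · intro w i j h hj
    rw [mem_comp] at *
    omega
  · intro y hy j x hx
    set A2 := FR.comp A1 with hA2
    have f3 : Fam a M (A2.image (shear y)) := f2.shear y
    have n1 : (y, (0 : ZMod p)) ∈ A2.image (shear y) := by rw [mem_shear]; simpa using hy
    have n2 : (y, (1 : ZMod p)) ∈ A2.image (shear y) := by rw [mem_shear]; simpa using m2
    have f4 := f3.comp ⟨_, one_mem_comp one_ne_zero n1 n2⟩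
    have hsub := sl_subset_comp (A2.image (shear y))
    rw [sl_shear] at hsub
    have heq := Finset.eq_of_subset_of_card_le hsub ((hmax _ f4).trans hc)
    rw [heq, mem_sl, mem_comp, ZMod.val_zero]
    refine Finset.card_pos.2 ⟨j, ?_⟩
    rw [mem_fib, mem_shear]
    simpa using hx

end
end FR

namespace FR
open Finset
set_option linter.unusedSectionVars false

lemma arith_gamma {p q r m h γ a M : ℝ} (hp : 5 ≤ p ∨ p = 3) (hN : p = 3 → q = 3 ∨ 9 ≤ q)
    (hr : 2 ≤ r) (hh : 0 < h) (hγ : 0 < γ) (hγh : γ ≤ h) (hrm : r ≤ m) (hm : m ≤ r * (r + 1) / 2)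
    (hG : Good p q r m) (ha : a = r * h + γ) (hM : m * h + r * h + γ ≤ M) :
    Good p (p * (q * h)) a M := by
  have h1 := Good.gamma hp hN hr (div_pos hγ hh) ((div_le_one hh).2 hγh) hrm hm hG
  have h2 := h1.scale hh
  have e1 : h * (r + γ / h) = a := by rw [ha]; field_simp
  have e2 : h * (m + r + γ / h) = m * h + r * h + γ := by field_simp
  have e3 : h * (p * q) = p * (q * h) := by ring
  rw [e1, e2, e3] at h2
  have ha0 : 0 < a := by rw [ha]; positivity
  refine h2.mono ha0 ?_ le_rfl ?_
  · rw [ha]; nlinarith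
  · gcongr

lemma arith_delta {p q r m h γ l a M : ℝ} (hp : 5 ≤ p ∨ p = 3) (hN : p = 3 → q = 3 ∨ 9 ≤ q)
    (hr : 4 ≤ r) (hh : 0 < h) (hγ : h ≤ γ) (hl : 2 ≤ l) (hγh : γ ≤ l * h) (hrm : r ≤ m)
    (hm : m ≤ r * (r + 1) / 2)
    (hG : Good p q r m) (ha : a = r * h + γ) (hM : m * h + l * (r * h) ≤ M) :
    Good p (p * (q * h)) a M := by
  have h1 := Good.gamma hp hN (by linarith) one_pos le_rfl hrm hm hG
  have h1' := Good.delta (g := γ / h) (l := l) hr ((one_le_div hh).2 hγ)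
    ((div_le_iff₀ hh).2 hγh) hl hrm hm h1
  have h2 := h1'.scale hh
  have e1 : h * (r + γ / h) = a := by rw [ha]; field_simp
  have e2 : h * (m + l * r) = m * h + l * (r * h) := by ring
  have e3 : h * (p * q) = p * (q * h) := by ring
  rw [e1, e2, e3] at h2
  have hr0 : 0 < r := by linarith
  have ha0 : 0 < a := by rw [ha]; nlinarith [mul_pos hr0 hh]
  refine h2.mono ha0 ?_ le_rfl ?_
  · rw [ha]
    have : 0 ≤ l * h * (r - 1) := by
      apply mul_nonneg; apply mul_nonneg <;> linarith
      linarith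
    nlinarith
  · gcongr

lemma card_add_self_le {G : Type} [AddCommGroup G] [DecidableEq G] (B : Finset G) :
    (#(B + B) : ℝ) ≤ #B * (#B + 1) / 2 := by
  have h : B + B ⊆ B.sym2.image (Sym2.lift ⟨fun a b => a + b, fun a b => add_comm a b⟩) := by
    intro x hx
    obtain ⟨a, ha, b, hb, rfl⟩ := Finset.mem_add.1 hx
    exact Finset.mem_image.2 ⟨s(a, b), by simp [ha, hb], rfl⟩
  have h2 := (Finset.card_le_card h).trans Finset.card_image_le
  rw [Finset.card_sym2] at h2
  have h3 : ((#B + 1).choose 2 : ℝ) = #B * (#B + 1) / 2 := by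
    rw [Nat.cast_choose_two]; push_cast; ring
  rw [← h3]; exact_mod_cast h2

lemma add_univ_of_card {G : Type} [AddCommGroup G] [DecidableEq G] [Fintype G] (X Y : Finset G)
    (h : Fintype.card G < #X + #Y) : X + Y = univ := by
  ext w
  simp only [mem_univ, iff_true]
  have hc : #(Y.image (fun y => w - y)) = #Y := Finset.card_image_of_injective _ (sub_right_injective)
  obtain ⟨x, hx⟩ := Finset.inter_nonempty_of_card_lt_card_add_card (s := univ)
    (t := X) (u := Y.image (fun y => w - y)) (subset_univ _) (subset_univ _)
    (by rw [hc]; simpa using h)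
  rw [Finset.mem_inter, Finset.mem_image] at hx
  obtain ⟨hx, y, hy, rfl⟩ := hx
  exact Finset.mem_add.2 ⟨_, hx, y, hy, by abel⟩

lemma sum_zmod {p : ℕ} [Fact p.Prime] (g : ZMod p → ℕ) : ∑ i, g i = ∑ k ∈ range p, g (k : ZMod p) := by
  refine Finset.sum_bij' (fun i _ => i.val) (fun k _ => (k : ZMod p)) ?_ ?_ ?_ ?_ ?_
  · intro i _; simpa using ZMod.val_lt i
  · simp
  · simp
  · intro k hk; simp at hk; simp [ZMod.val_natCast_of_lt hk]
  · simp

lemma card_of_inv {p : ℕ} [Fact p.Prime] {W : Type} [AddCommGroup W] [Module (ZMod p) W] [Fintype W]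
    [DecidableEq W] (H : Submodule (ZMod p) W) [DecidableEq (W ⧸ H)] (X : Finset W)
    (hX : ∀ x ∈ X, ∀ y ∈ H, x + y ∈ X) : #X = #(X.image H.mkQ) * Nat.card H := by
  classical
  rw [Finset.card_eq_sum_card_image H.mkQ X, Finset.sum_const_nat]
  intro b hb
  obtain ⟨x, hx, rfl⟩ := Finset.mem_image.1 hb
  rw [Nat.card_eq_fintype_card, ← Finset.card_univ]
  symm
  refine Finset.card_bij (fun y _ => x + y.1) ?_ ?_ ?_
  · intro y _
    rw [mem_filter]
    exact ⟨hX x hx y.1 y.2, by simp⟩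
  · intro a _ b _ h
    simpa using h
  · intro w hw
    simp only [mem_filter] at hw
    have : w - x ∈ H := by
      rw [← Submodule.Quotient.mk_eq_zero H, ← Submodule.mkQ_apply, map_sub, hw.2, sub_self]
    exact ⟨⟨w - x, this⟩, mem_univ _, by simp⟩

section
variable {p : ℕ} [Fact p.Prime] {W : Type} [AddCommGroup W] [Module (ZMod p) W] [Fintype W]
  [DecidableEq W]

lemma sl_add (A : Finset (W × ZMod p)) (i j : ZMod p) : sl A i + sl A j ⊆ sl (A + A) (i + j) := by
  intro x hx
  obtain ⟨a, ha, b, hb, rfl⟩ := Finset.mem_add.1 hx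
  rw [mem_sl] at *
  exact Finset.mem_add.2 ⟨_, ha, _, hb, rfl⟩

lemma core_full (hp : 5 ≤ (p : ℝ) ∨ (p : ℝ) = 3) (A : Finset (W × ZMod p))
    (h0 : sl A 0 = univ) (h1 : ((0 : W), (1 : ZMod p)) ∈ A)
    (hn : ∀ w i j, (w, i) ∈ A → j.val ≤ i.val → (w, j) ∈ A) :
    Good p (p * Fintype.card W) #A #(A + A) := by
  set N := Fintype.card W with hNdef
  have hN0 : 0 < N := Fintype.card_pos
  set f : ℕ → ℕ := fun k => #(sl A (k : ZMod p)) with hf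
  set S : ℕ → ℕ := fun k => #(sl (A + A) (k : ZMod p)) with hS
  have ha : #A = ∑ k ∈ range p, f k := by rw [card_eq_sl, sum_zmod]
  have hM : #(A + A) = ∑ k ∈ range p, S k := by rw [card_eq_sl, sum_zmod]
  have hfN : ∀ k, f k ≤ N := fun k => Finset.card_le_univ _
  have hSN : ∀ k, S k ≤ N := fun k => Finset.card_le_univ _
  have hf0 : f 0 = N := by simp [hf, h0, hNdef]
  have hf1 : 0 < f 1 := Finset.card_pos.2 ⟨0, by simpa using h1⟩
  have hApos : 0 < #A := Finset.card_pos.2 ⟨_, h1⟩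
  have haM : #A ≤ #(A + A) := Finset.card_le_card_add_right ⟨_, h1⟩
  have hadd : ∀ i j : ℕ, #(sl A (i : ZMod p) + sl A (j : ZMod p)) ≤ S (i + j) := by
    intro i j
    have := Finset.card_le_card (sl_add A (i : ZMod p) (j : ZMod p))
    simpa [hS] using this
  have hSf : ∀ k, 0 < f k → S k = N := by
    intro k hk
    apply le_antisymm (hSN k)
    have h2 := hadd 0 k
    rw [zero_add] at h2
    refine le_trans ?_ h2
    rw [← hf0]
    exact Finset.card_le_card_add_right (Finset.card_pos.1 hk)
  by_cases hall : ∀ k < p, S k = N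
  · apply Good.full hp (by exact_mod_cast hApos) (by exact_mod_cast haM)
    rw [hM, Finset.sum_congr rfl (fun k hk => hall k (by simpa using hk))]
    simp
  · push Not at hall
    have hz := Nat.find_spec hall
    have hmin : ∀ k < Nat.find hall, S k = N := by
      intro k hk
      have := Nat.find_min hall hk
      push Not at this
      exact this (hk.trans hz.1)
    generalize Nat.find hall = z at hz hmin
    obtain ⟨hzp, hzS⟩ := hz
    have hfz : f z = 0 := by
      by_contra hc
      exact hzS (hSf z (Nat.pos_of_ne_zero hc))
    have hfk : ∀ k, z ≤ k → k < p → f k = 0 := by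
      intro k hk hkp
      have : sl A (k : ZMod p) ⊆ sl A (z : ZMod p) := by
        intro w hw
        rw [mem_sl] at *
        apply hn w _ _ hw
        rwa [ZMod.val_natCast_of_lt hzp, ZMod.val_natCast_of_lt hkp]
      have := Finset.card_le_card this
      have : f k ≤ f z := this
      omega
    have hz2 : 2 ≤ z := by
      by_contra hc
      have : z = 0 ∨ z = 1 := by omega
      rcases this with h | h
      · rw [h] at hfz; omega
      · rw [h] at hfz; omega
    have hpair : ∀ i ∈ range (z + 1), f i + f (z - i) ≤ N := by
      intro i hi
      simp at hi
      by_contra hc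
      push Not at hc
      have := add_univ_of_card (sl A (i : ZMod p)) (sl A ((z - i : ℕ) : ZMod p)) hc
      have h3 := hadd i (z - i)
      rw [this, Nat.add_sub_cancel' (by omega), Finset.card_univ] at h3
      exact hzS (le_antisymm (hSN z) h3)
    have ha1 : #A = ∑ k ∈ range z, f k := by
      rw [ha]
      symm
      apply Finset.sum_subset
      · intro x; simp; omega
      · intro x hx hx2
        simp at hx hx2
        exact hfk x hx2 hx
    have ha2 : #A = ∑ k ∈ range (z + 1), f k := by
      rw [Finset.sum_range_succ, hfz, ha1, add_zero]
    have h2a : 2 * #A ≤ (z + 1) * N := by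
      have h4 := Finset.sum_le_sum hpair
      rw [Finset.sum_add_distrib, Finset.sum_flip, ← ha2] at h4
      simp at h4
      linarith
    have hMz : z * N + S z ≤ #(A + A) := by
      rw [hM]
      have : ∑ k ∈ range (z + 1), S k ≤ ∑ k ∈ range p, S k :=
        Finset.sum_le_sum_of_subset (by intro x; simp; omega)
      rw [Finset.sum_range_succ, Finset.sum_congr rfl (fun k hk => hmin k (by simpa using hk))] at this
      simpa using this
    have haN : #A + N ≤ #(A + A) := by
      obtain ⟨y, rfl⟩ : ∃ y, z = y + 2 := ⟨z - 2, by omega⟩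
      by_cases hy : f (y + 1) = 0
      · rw [Finset.sum_range_succ, hy, add_zero] at ha1
        have : #A ≤ (y + 1) * N := by
          rw [ha1]
          refine (Finset.sum_le_card_nsmul _ _ N (fun k _ => hfN k)).trans ?_
          simp
        nlinarith
      · have h5 : f 1 ≤ S (y + 2) := by
          have h6 := hadd 1 (y + 1)
          rw [show 1 + (y + 1) = y + 2 by ring] at h6
          exact (Finset.card_le_card_add_right (Finset.card_pos.1 (Nat.pos_of_ne_zero hy))).trans h6
        rw [Finset.sum_range_succ', Finset.sum_range_succ', zero_add] at ha1
        have : ∑ k ∈ range y, f (k + 1 + 1) ≤ y * N := by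
          refine (Finset.sum_le_card_nsmul _ _ N (fun k _ => hfN _)).trans ?_
          simp
        nlinarith
    apply Good.beta hp (by exact_mod_cast hN0)
    · have : N ≤ #A := by rw [← hf0, ha1]; exact Finset.single_le_sum (fun _ _ => Nat.zero_le _) (by simp; omega)
      exact_mod_cast this
    · exact_mod_cast haN
    · have h7 : 2 * #A ≤ #(A + A) + N := by nlinarith
      have : (2 * #A : ℝ) ≤ #(A + A) + N := by exact_mod_cast h7
      linarith

end
end FR

namespace FR
open Finset
set_option linter.unusedSectionVars false

section
variable {p : ℕ} [Fact p.Prime] {W : Type} [AddCommGroup W] [Module (ZMod p) W] [Fintype W]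
  [DecidableEq W]

def stab (X : Finset W) : Submodule (ZMod p) W where
  carrier := {x | ∀ y ∈ X, x + y ∈ X}
  zero_mem' := by intro y hy; simpa using hy
  add_mem' := by
    intro a b ha hb y hy
    rw [add_assoc]; exact ha _ (hb _ hy)
  smul_mem' := by
    intro c x hx
    have h : ∀ n : ℕ, ∀ y ∈ X, n • x + y ∈ X := by
      intro n
      induction n with
      | zero => intro y hy; simpa using hy
      | succ n ih =>
        intro y hy
        rw [succ_nsmul, add_assoc]
        exact ih _ (hx _ hy)
    intro y hy
    have := h c.val y hy
    rwa [← Nat.cast_smul_eq_nsmul (ZMod p), ZMod.natCast_zmod_val] at this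

lemma mem_stab {X : Finset W} {x : W} : x ∈ stab (p := p) X ↔ ∀ y ∈ X, x + y ∈ X := Iff.rfl

def IHyp (p N : ℕ) [Fact p.Prime] : Prop :=
  ∀ (V : Type) [AddCommGroup V] [Module (ZMod p) V] [Finite V] [DecidableEq V], Nat.card V < N →
    ∀ B : Finset V, 0 ∈ B → Submodule.span (ZMod p) (B : Set V) = ⊤ →
      Good p (Nat.card V) #B #(B + B)

/-- A subset of a quotient containing zero, closed under doubling and spanning. -/
lemma four_le {Q : Type} [AddCommGroup Q] [Module (ZMod p) Q] [DecidableEq Q]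
    (hp : 2 < p) (B : Finset Q) (h0 : 0 ∈ B)
    (hsp : Submodule.span (ZMod p) (B : Set Q) = ⊤) (hne : ∃ q, q ∉ B)
    (h2 : ∀ b ∈ B, (2 : ZMod p) • b ∈ B) : 4 ≤ #B := by
  have hex : ∃ x ∈ B, x ≠ 0 := by
    by_contra hc
    push Not at hc
    have : Submodule.span (ZMod p) (B : Set Q) ≤ ⊥ := Submodule.span_le.2 (fun x hx => by
      simpa using hc x hx)
    rw [hsp] at this
    obtain ⟨q, hq⟩ := hne
    have hq0 : q = 0 := by simpa using this (Submodule.mem_top : q ∈ ⊤)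
    exact hq (hq0 ▸ h0)
  obtain ⟨x, hx, hx0⟩ := hex
  have hx2 := h2 x hx
  have hx4 := h2 _ hx2
  have hinj : ∀ a b : ℕ, a < p → b < p → (a : ZMod p) • x = (b : ZMod p) • x → a = b := by
    intro a b ha hb hab
    have := smul_left_injective (ZMod p) hx0 hab
    rw [ZMod.natCast_eq_natCast_iff'] at this
    rwa [Nat.mod_eq_of_lt ha, Nat.mod_eq_of_lt hb] at this
  have n20 : (2 : ZMod p) • x ≠ 0 := by
    intro h
    have := hinj 2 0 (by omega) (by omega) (by simpa using h)
    omega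
  have n21 : (2 : ZMod p) • x ≠ x := by
    intro h
    have := hinj 2 1 (by omega) (by omega) (by simpa using h)
    omega
  by_cases hp3 : p = 3
  · -- the line through x is a subspace
    by_contra hc
    push Not at hc
    have hsub : ({0, x, (2 : ZMod p) • x} : Finset Q) ⊆ B := by
      intro y hy
      simp only [mem_insert, mem_singleton] at hy
      rcases hy with rfl | rfl | rfl <;> assumption
    have hcard : #({0, x, (2 : ZMod p) • x} : Finset Q) = 3 := by
      rw [Finset.card_eq_three]
      exact ⟨0, x, _, hx0.symm, n20.symm, n21.symm, rfl⟩
    have heq := Finset.eq_of_subset_of_card_le hsub (by omega)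
    obtain ⟨q, hq⟩ := hne
    have hle : Submodule.span (ZMod p) (B : Set Q) ≤ Submodule.span (ZMod p) {x} := by
      rw [← heq]
      refine Submodule.span_le.2 (fun y hy => ?_)
      have hxs := Submodule.mem_span_singleton_self (R := ZMod p) x
      simp only [coe_insert, coe_singleton, Set.mem_insert_iff, Set.mem_singleton_iff] at hy
      rcases hy with rfl | rfl | rfl
      · exact Submodule.zero_mem _
      · exact hxs
      · exact Submodule.smul_mem _ _ hxs
    rw [hsp] at hle
    obtain ⟨c, rfl⟩ := Submodule.mem_span_singleton.1 (hle (Submodule.mem_top : q ∈ ⊤))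
    apply hq
    have hcv := ZMod.val_lt c
    have hc' : c = (c.val : ZMod p) := by simp
    rw [← heq, hc']
    replace hcv : c.val < 3 := lt_of_lt_of_eq hcv hp3
    generalize c.val = v at *
    interval_cases v <;> simp
  · have hp5 : 4 < p := by
      have : p ≠ 4 := by
        rintro rfl
        have := (Fact.out : Nat.Prime 4)
        norm_num at this
      omega
    have hsub : ({0, x, (2 : ZMod p) • x, (2 : ZMod p) • (2 : ZMod p) • x} : Finset Q) ⊆ B := by
      intro y hy
      simp only [mem_insert, mem_singleton] at hy
      rcases hy with rfl | rfl | rfl | rfl <;> assumption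
    have e4 : (2 : ZMod p) • (2 : ZMod p) • x = ((4 : ℕ) : ZMod p) • x := by
      rw [smul_smul]; norm_num
    have n40 : (2 : ZMod p) • (2 : ZMod p) • x ≠ 0 := by
      intro h
      have := hinj 4 0 (by omega) (by omega) (by rw [← e4, h]; simp)
      omega
    have n41 : (2 : ZMod p) • (2 : ZMod p) • x ≠ x := by
      intro h
      have := hinj 4 1 (by omega) (by omega) (by rw [← e4, h]; simp)
      omega
    have n42 : (2 : ZMod p) • (2 : ZMod p) • x ≠ (2 : ZMod p) • x := by
      intro h
      have := hinj 4 2 (by omega) (by omega) (by rw [← e4, h]; simp)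
      omega
    have hcard : #({0, x, (2 : ZMod p) • x, (2 : ZMod p) • (2 : ZMod p) • x} : Finset Q) = 4 := by
      rw [Finset.card_insert_of_notMem, Finset.card_eq_three.2]
      · exact ⟨x, _, _, n21.symm, n41.symm, n42.symm, rfl⟩
      · simp only [mem_insert, mem_singleton, not_or]
        exact ⟨hx0.symm, n20.symm, n40.symm⟩
    rw [← hcard]
    exact Finset.card_le_card hsub

lemma core_proper (hp2 : 2 < p) (hp : 5 ≤ (p : ℝ) ∨ (p : ℝ) = 3) {N : ℕ} (ih : IHyp p N)
    (A : Finset (W × ZMod p)) (hN : Nat.card W < N)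
    (h00 : ((0 : W), (0 : ZMod p)) ∈ A)
    (h0 : sl A 0 ≠ univ) (h1 : ((0 : W), (1 : ZMod p)) ∈ A)
    (hsp : Submodule.span (ZMod p) (sl A 0 : Set W) = ⊤)
    (hn : ∀ w i j, (w, i) ∈ A → j.val ≤ i.val → (w, j) ∈ A)
    (hS : ∀ y ∈ sl A 0, ∀ j, ∀ x ∈ sl A j, x + j • y ∈ sl A 0) :
    Good p (p * Nat.card W) #A #(A + A) := by
  classical
  have : Fact (1 < p) := ⟨by omega⟩
  have z0 : (0 : W) ∈ sl A 0 := by simpa using h00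
  set H := stab (p := p) (sl A 0) with hH
  have hA1 : ∀ i ≠ 0, ∀ x ∈ sl A i, x ∈ H := by
    intro i hi x hx
    rw [hH, mem_stab]
    intro y hy
    have hx1 : x ∈ sl A 1 := by
      rw [mem_sl] at *
      apply hn _ _ _ hx
      rw [ZMod.val_one]
      have := (ZMod.val_ne_zero i).2 hi
      omega
    simpa using hS y hy 1 x hx1
  set B := (sl A 0).image H.mkQ with hB
  have hB0 : 0 ∈ B := by
    rw [hB, mem_image]; exact ⟨0, z0, by simp⟩
  have hBsp : Submodule.span (ZMod p) (B : Set (W ⧸ H)) = ⊤ := by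
    rw [hB, Finset.coe_image, ← Submodule.map_span, hsp, Submodule.map_top, Submodule.range_mkQ]
  have hinv0 : ∀ x ∈ sl A 0, ∀ y ∈ H, x + y ∈ sl A 0 := by
    intro x hx y hy
    rw [add_comm]; exact hy x hx
  have hinv1 : ∀ x ∈ sl A 0 + sl A 0, ∀ y ∈ H, x + y ∈ sl A 0 + sl A 0 := by
    intro x hx y hy
    obtain ⟨a, ha, b, hb, rfl⟩ := Finset.mem_add.1 hx
    rw [add_assoc]
    exact Finset.add_mem_add ha (hinv0 b hb y hy)
  have hc0 := card_of_inv H _ hinv0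
  have hc1 := card_of_inv H _ hinv1
  have himg : (sl A 0 + sl A 0).image H.mkQ = B + B := by rw [hB, Finset.image_add]
  rw [himg] at hc1
  rw [← hB] at hc0
  have hBne : ∃ q, q ∉ B := by
    obtain ⟨w, hw⟩ : ∃ w, w ∉ sl A 0 := by
      by_contra hc
      push Not at hc
      exact h0 (by ext; simp [hc])
    refine ⟨H.mkQ w, fun hc => hw ?_⟩
    obtain ⟨x, hx, he⟩ := Finset.mem_image.1 hc
    have : w - x ∈ H := by
      rw [← Submodule.Quotient.mk_eq_zero H, ← Submodule.mkQ_apply, map_sub, he, sub_self]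
    simpa using hinv0 x hx _ this
  have hcW : Nat.card W = Nat.card (W ⧸ H) * Nat.card H := by
    rw [mul_comm]; exact Submodule.card_eq_card_quotient_mul_card H
  set h := Nat.card H with hhdef
  have hh : 0 < h := Nat.card_pos
  have hG : Good p (Nat.card (W ⧸ H)) #B #(B + B) := by
    apply ih _ _ B hB0 hBsp
    refine lt_of_le_of_lt ?_ hN
    rw [hcW]; exact Nat.le_mul_of_pos_right _ hh
  have hr2 : 2 ≤ #B := by
    by_contra hc
    have h1' : #B = 1 := by
      have := Finset.card_pos.2 ⟨_, hB0⟩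
      omega
    obtain ⟨b, hb⟩ := Finset.card_eq_one.1 h1'
    have hb0 : b = 0 := by rw [hb] at hB0; exact (Finset.mem_singleton.1 hB0).symm
    obtain ⟨q, hq⟩ := hBne
    rw [hb, hb0] at hBsp
    have : q ∈ (⊤ : Submodule (ZMod p) (W ⧸ H)) := Submodule.mem_top
    rw [← hBsp] at this
    have : q = 0 := by simpa using this
    rw [this] at hq
    exact hq hB0
  have hrm : #B ≤ #(B + B) := Finset.card_le_card_add_right ⟨_, hB0⟩
  have hmr := card_add_self_le B
  have hq3 : (p : ℝ) = 3 → (Nat.card (W ⧸ H) : ℝ) = 3 ∨ 9 ≤ (Nat.card (W ⧸ H) : ℝ) := by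
    intro hp3
    have hp3' : p = 3 := by exact_mod_cast hp3
    have hcq : Nat.card (W ⧸ H) = 3 ^ Module.finrank (ZMod p) (W ⧸ H) := by
      rw [Module.natCard_eq_pow_finrank (K := ZMod p), Nat.card_zmod]
      congr 1
    have hBc : #B ≤ Nat.card (W ⧸ H) := by
      have : Fintype (W ⧸ H) := Fintype.ofFinite _
      rw [Nat.card_eq_fintype_card]; exact Finset.card_le_univ _
    rcases hu : Module.finrank (ZMod p) (W ⧸ H) with _ | _ | u
    · rw [hu, pow_zero] at hcq; omega
    · left; rw [hcq, hu]; norm_num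
    · right; rw [hcq, hu]
      have : (1 : ℝ) ≤ 3 ^ u := one_le_pow₀ (by norm_num)
      push_cast
      rw [pow_add, pow_add]; linarith
  -- slices
  set I := univ.filter (fun i : ZMod p => i ≠ 0 ∧ (sl A i).Nonempty) with hI
  set γ := ∑ i ∈ I, #(sl A i) with hγ
  have h0I : (0 : ZMod p) ∉ I := by simp [hI]
  have h1I : (1 : ZMod p) ∈ I := by
    simp only [hI, mem_filter, mem_univ, true_and]
    exact ⟨one_ne_zero, 0, by simpa using h1⟩
  have ha : #A = #B * h + γ := by
    rw [card_eq_sl, ← hc0, hγ, ← Finset.sum_insert (f := fun i => #(sl A i)) h0I]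
    symm
    apply Finset.sum_subset (subset_univ _)
    intro i _ hi
    simp only [hI, mem_insert, mem_filter, mem_univ, true_and, not_or, not_and,
      Finset.not_nonempty_iff_eq_empty] at hi
    rw [hi.2 hi.1]; rfl
  have hslH : ∀ i ∈ I, #(sl A i) ≤ h := by
    intro i hi
    have hi' : i ≠ 0 := by rintro rfl; exact h0I hi
    have : (sl A i : Set W) ⊆ (H : Set W) := fun x hx => hA1 i hi' x hx
    have h3 := Set.ncard_le_ncard this (Set.toFinite _)
    rwa [Set.ncard_coe_finset] at h3
  have hγl : γ ≤ #I * h := by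
    rw [hγ]
    exact (Finset.sum_le_card_nsmul _ _ h hslH).trans (by simp)
  have hγ0 : 0 < γ := by
    have h3 : #(sl A 1) ≤ γ := Finset.single_le_sum (f := fun i => #(sl A i))
      (fun _ _ => Nat.zero_le _) h1I
    have : 0 < #(sl A 1) := Finset.card_pos.2 ⟨0, by simpa using h1⟩
    omega
  have hl1 : 1 ≤ #I := Finset.card_pos.2 ⟨_, h1I⟩
  have hS0 : #(B + B) * h ≤ #(sl (A + A) 0) := by
    rw [← hc1]
    have := Finset.card_le_card (sl_add A 0 0)
    simpa using this
  have hSi : ∀ i ∈ I, #B * h ≤ #(sl (A + A) i) := by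
    intro i hi
    rw [← hc0]
    have h3 := Finset.card_le_card (sl_add A 0 i)
    rw [zero_add] at h3
    refine le_trans ?_ h3
    simp only [hI, mem_filter] at hi
    exact Finset.card_le_card_add_right hi.2.2
  have hMl : #(B + B) * h + #I * (#B * h) ≤ #(A + A) := by
    rw [card_eq_sl (A + A)]
    have h3 : ∑ i ∈ insert 0 I, #(sl (A + A) i) ≤ ∑ i, #(sl (A + A) i) :=
      Finset.sum_le_sum_of_subset (subset_univ _)
    rw [Finset.sum_insert h0I] at h3
    have h4 := Finset.card_nsmul_le_sum I (fun i => #(sl (A + A) i)) _ hSi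
    simp only [smul_eq_mul] at h4
    omega
  rw [hcW]
  push_cast
  have hhR : (0 : ℝ) < h := by exact_mod_cast hh
  have haR : (#A : ℝ) = #B * h + γ := by exact_mod_cast ha
  have hγ0R : (0 : ℝ) < γ := by exact_mod_cast hγ0
  have hr2R : (2 : ℝ) ≤ #B := by exact_mod_cast hr2
  have hrmR : (#B : ℝ) ≤ #(B + B) := by exact_mod_cast hrm
  rcases Nat.lt_or_ge 1 #I with hl2 | hl2
  · rcases le_total γ h with hgh | hgh
    · refine arith_gamma hp hq3 hr2R hhR hγ0R (by exact_mod_cast hgh) hrmR hmr hG haR ?_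
      have : #(B + B) * h + #B * h + γ ≤ #(A + A) := by
        have h5 : 2 * (#B * h) ≤ #I * (#B * h) := Nat.mul_le_mul_right _ hl2
        have h6 : h ≤ #B * h := Nat.le_mul_of_pos_left _ (by omega)
        omega
      exact_mod_cast this
    · have h2ne : (sl A 2).Nonempty := by
        obtain ⟨i, hi, hi1⟩ := Finset.exists_mem_ne hl2 1
        simp only [hI, mem_filter, mem_univ, true_and] at hi
        obtain ⟨hi0, w, hw⟩ := hi
        refine ⟨w, ?_⟩
        rw [mem_sl] at *
        apply hn _ _ _ hw
        have e2 : (2 : ZMod p).val = 2 := by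
          have := ZMod.val_natCast_of_lt hp2
          simpa using this
        rw [e2]
        have h7 := (ZMod.val_ne_zero i).2 hi0
        have h8 : i.val ≠ 1 := by
          intro hv
          apply hi1
          apply ZMod.val_injective p
          rw [hv, ZMod.val_one]
        omega
      have hr4 : 4 ≤ #B := by
        refine four_le hp2 B hB0 hBsp hBne ?_
        intro b hb
        obtain ⟨y, hy, rfl⟩ := Finset.mem_image.1 hb
        obtain ⟨x, hx⟩ := h2ne
        have h20 : (2 : ZMod p) ≠ 0 := by
          intro hc
          have := congrArg ZMod.val hc
          have e2 : (2 : ZMod p).val = 2 := by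
            have := ZMod.val_natCast_of_lt hp2
            simpa using this
          rw [e2, ZMod.val_zero] at this
          omega
        refine Finset.mem_image.2 ⟨_, hS y hy 2 x hx, ?_⟩
        have hxH : H.mkQ x = 0 := by
          rw [Submodule.mkQ_apply, Submodule.Quotient.mk_eq_zero]; exact hA1 2 h20 x hx
        rw [map_add, map_smul, hxH, zero_add]
      refine arith_delta (l := #I) hp hq3 (by exact_mod_cast hr4) hhR (by exact_mod_cast hgh)
        (by exact_mod_cast hl2) (by exact_mod_cast hγl) hrmR hmr hG haR ?_
      exact_mod_cast hMl
  · have hl : #I = 1 := by omega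
    obtain ⟨i, hi⟩ := Finset.card_eq_one.1 hl
    have hi1 : i = 1 := by rw [hi] at h1I; exact (Finset.mem_singleton.1 h1I).symm
    subst hi1
    have hγ1 : γ = #(sl A 1) := by rw [hγ, hi]; simp
    refine arith_gamma hp hq3 hr2R hhR hγ0R ?_ hrmR hmr hG haR ?_
    · rw [hl, one_mul] at hγl; exact_mod_cast hγl
    · have h3 : ∑ i ∈ ({0, 1, 2} : Finset (ZMod p)), #(sl (A + A) i) ≤ #(A + A) := by
        rw [card_eq_sl (A + A)]
        exact Finset.sum_le_sum_of_subset (subset_univ _)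
      have e2 : (2 : ZMod p).val = 2 := by
        have := ZMod.val_natCast_of_lt hp2
        simpa using this
      have n02 : (0 : ZMod p) ≠ 2 := by
        intro hc
        have := congrArg ZMod.val hc
        rw [e2, ZMod.val_zero] at this
        omega
      have n12 : (1 : ZMod p) ≠ 2 := by
        intro hc
        have := congrArg ZMod.val hc
        rw [e2, ZMod.val_one] at this
        omega
      rw [Finset.sum_insert (by simp [n02]), Finset.sum_insert (by simp [n12]),
        Finset.sum_singleton] at h3
      have h4 := hSi 1 h1I
      have h5 : γ ≤ #(sl (A + A) 2) := by
        rw [hγ1]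
        have h6 := Finset.card_le_card (sl_add A 1 1)
        rw [one_add_one_eq_two] at h6
        exact le_trans (Finset.card_le_card_add_right ⟨0, by simpa using h1⟩) h6
      have : #(B + B) * h + #B * h + γ ≤ #(A + A) := by omega
      exact_mod_cast this

end
end FR

namespace FR
open Finset

lemma decomp {p : ℕ} [Fact p.Prime] {V : Type} [AddCommGroup V] [Module (ZMod p) V] [Finite V]
    [Nontrivial V] (A : Set V) (hsp : Submodule.span (ZMod p) A = ⊤) :
    ∃ (ι : Type) (_ : Fintype ι) (_ : DecidableEq ι) (φ : V ≃ₗ[ZMod p] ((ι → ZMod p) × ZMod p)),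
      (∀ j : ι, ∃ a ∈ A, φ a = (Pi.single j 1, 0)) ∧ ∃ a ∈ A, φ a = (0, 1) := by
  classical
  obtain ⟨b, hbA, hbs, hli⟩ := exists_linearIndependent (ZMod p) A
  have : Fintype b := Fintype.ofFinite _
  let bas : Module.Basis b (ZMod p) V := Module.Basis.mk hli (by simp [hbs, hsp])
  have hbas : ∀ i, bas i = i.1 := fun i => by simp [bas]
  have hne : Nonempty b := bas.index_nonempty
  obtain ⟨i0⟩ := hne
  let spl : (b → ZMod p) ≃ₗ[ZMod p] (ZMod p × ({j : b // j ≠ i0} → ZMod p)) :=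
    { Equiv.funSplitAt i0 (ZMod p) with
      map_add' := fun _ _ => rfl
      map_smul' := fun _ _ => rfl }
  have hspl : ∀ f, spl f = (f i0, fun j => f j.1) := fun _ => rfl
  refine ⟨{j : b // j ≠ i0}, inferInstance, inferInstance,
    bas.equivFun.trans (spl.trans
      (LinearEquiv.prodComm _ _ _)), ?_, ?_⟩
  · intro j
    refine ⟨j.1.1, hbA j.1.2, ?_⟩
    rw [← hbas]
    ext x
    · simp [hspl, Finsupp.single_apply, Pi.single_apply, Subtype.ext_iff, eq_comm]
    · simp [hspl, Finsupp.single_apply, j.2]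
  · refine ⟨i0.1, hbA i0.2, ?_⟩
    rw [← hbas]
    ext x
    · simp [hspl, Finsupp.single_apply, x.2.symm]
    · simp [hspl]

theorem main_good {p : ℕ} [Fact p.Prime] (hp2 : 2 < p) (hp : 5 ≤ (p : ℝ) ∨ (p : ℝ) = 3) (N : ℕ) :
    IHyp p N := by
  induction N with
  | zero => intro V _ _ _ _ h; omega
  | succ N ih =>
    intro V _ _ _ _ hV B hB0 hsp
    have hB1 : 0 < #B := Finset.card_pos.2 ⟨_, hB0⟩
    have hBB : #B ≤ #(B + B) := Finset.card_le_card_add_right ⟨_, hB0⟩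
    rcases subsingleton_or_nontrivial V with hs | hs
    · apply Good.full hp (by exact_mod_cast hB1) (by exact_mod_cast hBB)
      have : Nat.card V = 1 := Nat.card_eq_one_iff_unique.2 ⟨hs, ⟨0⟩⟩
      rw [this]
      have : 1 ≤ #(B + B) := by omega
      exact_mod_cast this
    · obtain ⟨ι, _, _, φ, h1, a1, ha1, hφ1⟩ := decomp (B : Set V) hsp
      set A := B.image φ with hA
      have hcV : Nat.card V = p * Fintype.card (ι → ZMod p) := by
        rw [Nat.card_congr φ.toEquiv, Nat.card_prod, Nat.card_zmod, Nat.card_eq_fintype_card, mul_comm]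
      have hcA : #A = #B := Finset.card_image_of_injective _ φ.injective
      have hcAA : #(A + A) = #(B + B) := by
        rw [hA, ← Finset.image_add, Finset.card_image_of_injective _ φ.injective]
      have fam : Fam #B #(B + B) A := by
        refine ⟨hcA, hcAA.le, ?_, ?_, ?_⟩
        · exact Finset.mem_image.2 ⟨0, hB0, by rw [map_zero]; rfl⟩
        · rw [eq_top_iff, ← (Pi.basisFun (ZMod p) ι).span_eq]
          apply Submodule.span_mono
          rintro _ ⟨j, rfl⟩
          obtain ⟨a, ha, haj⟩ := h1 j
          rw [Pi.basisFun_apply, Finset.mem_coe, mem_sl]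
          exact Finset.mem_image.2 ⟨a, ha, haj⟩
        · exact ⟨_, Finset.mem_image_of_mem φ ha1, by rw [hφ1]; exact one_ne_zero⟩
      obtain ⟨A', fam', h01, hn, hS⟩ := exists_nested fam
      have hcW : 0 < Fintype.card (ι → ZMod p) := Fintype.card_pos
      have hg : Good p (p * Fintype.card (ι → ZMod p)) #A' #(A' + A') := by
        by_cases h0 : sl A' 0 = univ
        · exact core_full hp A' h0 h01 hn
        · have := core_proper hp2 hp ih A' (by
            rw [Nat.card_eq_fintype_card]
            nlinarith) fam'.z h0 h01 fam'.sp hn hS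
          rwa [Nat.card_eq_fintype_card] at this
      rw [hcV]
      push_cast
      push_cast at hg
      have hA'1 : 0 < #A' := Finset.card_pos.2 ⟨_, h01⟩
      have hA'2 : #A' ≤ #(A' + A') := Finset.card_le_card_add_right ⟨_, h01⟩
      have e := fam'.c1
      refine hg.mono (by exact_mod_cast hA'1) (by exact_mod_cast hA'2) (by rw [e]) ?_
      rw [e]
      have := fam'.c2
      gcongr

end FR

theorem statement0 (p : ℕ) (hp : p.Prime) (hp2 : 2 < p) (K : ℝ) (hK : 8 ≤ K)
    (n : ℕ) (hn : 1 ≤ n) (A : Set (Fin n → ZMod p)) (hA : A.Nonempty)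
    (hdouble : ((A + A).ncard : ℝ) ≤ K * A.ncard) :
    ((affSpan A).ncard : ℝ) ≤ (p : ℝ) ^ (2 * K - 2) / (2 * K - 1) * A.ncard := by
  classical
  have : Fact p.Prime := ⟨hp⟩
  have hp' : 5 ≤ (p : ℝ) ∨ (p : ℝ) = 3 := by
    have h4 : p ≠ 4 := by rintro rfl; norm_num at hp
    have : 5 ≤ p ∨ p = 3 := by omega
    rcases this with h | h
    · left; exact_mod_cast h
    · right; exact_mod_cast h
  obtain ⟨a0, ha0⟩ := hA
  set s : Set (Fin n → ZMod p) := (fun x => x - a0) '' A with hs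
  set S := Submodule.span (ZMod p) s with hS
  have hmemS : ∀ x ∈ A, x - a0 ∈ S := fun x hx => Submodule.subset_span ⟨x, hx, rfl⟩
  let B : Finset S := Finset.univ.filter (fun v : S => (v : Fin n → ZMod p) + a0 ∈ A)
  have hBmem : ∀ v : S, v ∈ B ↔ (v : Fin n → ZMod p) + a0 ∈ A := by intro v; simp [B]
  have hBcoe : (B : Set S) = (Subtype.val ⁻¹' s : Set S) := by
    ext v
    rw [Finset.mem_coe, hBmem, Set.mem_preimage, hs]
    constructor
    · intro h; exact ⟨_, h, by simp⟩
    · rintro ⟨x, hx, he⟩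
      simp only at he
      rw [← he]; simpa using hx
  have hB0 : (0 : S) ∈ B := by rw [hBmem]; simpa using ha0
  have hBsp : Submodule.span (ZMod p) (B : Set S) = ⊤ := by
    rw [hBcoe]; exact Submodule.span_span_coe_preimage
  have hcB : B.card = A.ncard := by
    rw [← Set.ncard_coe_finset]
    have : (fun v : S => (v : Fin n → ZMod p) + a0) '' (B : Set S) = A := by
      ext x
      constructor
      · rintro ⟨v, hv, rfl⟩
        exact (hBmem v).1 hv
      · intro hx
        exact ⟨⟨x - a0, hmemS x hx⟩, (hBmem _).2 (by simpa using hx), by simp⟩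
    rw [← this, Set.ncard_image_of_injective]
    intro a b hab
    exact Subtype.ext (add_right_cancel hab)
  have hcBB : (B + B).card ≤ (A + A).ncard := by
    rw [← Set.ncard_coe_finset]
    refine Set.ncard_le_ncard_of_injOn (fun v : S => (v : Fin n → ZMod p) + (a0 + a0)) ?_ ?_
      (Set.toFinite _)
    · intro v hv
      obtain ⟨x, hx, y, hy, rfl⟩ := Finset.mem_add.1 hv
      refine Set.mem_add.2 ⟨_, (hBmem x).1 hx, _, (hBmem y).1 hy, ?_⟩
      push_cast
      abel
    · intro a _ b _ hab
      exact Subtype.ext (add_right_cancel hab)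
  have hspan : (affSpan A).ncard ≤ Nat.card S := by
    have hsub : affSpan A ⊆ a0 +ᵥ (S.toAddSubgroup : Set (Fin n → ZMod p)) := by
      apply Set.sInter_subset_of_mem
      refine ⟨?_, S.toAddSubgroup, a0, rfl⟩
      intro x hx
      refine Set.mem_vadd_set.2 ⟨x - a0, hmemS x hx, ?_⟩
      simp
    refine (Set.ncard_le_ncard hsub (Set.toFinite _)).trans ?_
    rw [Set.ncard_vadd_set]
    exact le_rfl
  have hgood := FR.main_good hp2 hp' (Nat.card S + 1) S (Nat.lt_succ_self _) B hB0 hBsp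
  have hB1 : 0 < B.card := Finset.card_pos.2 ⟨_, hB0⟩
  have hBB : B.card ≤ (B + B).card := Finset.card_le_card_add_right ⟨_, hB0⟩
  have hfin := hgood.final (K := K) (by exact_mod_cast hB1) (by exact_mod_cast hBB) hK (by
    rw [hcB]
    exact le_trans (by exact_mod_cast hcBB) hdouble)
  rw [hcB] at hfin
  exact le_trans (by exact_mod_cast hspan) hfin
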